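/- Let (X,d) be a proper geodesic metric space that is a Morse local-to-global space and contains a Morse geodesic ray. If a group G acts geometrically (properly and cocompactly) by isometries on X, then G contains a Morse element. -/

import Mathlib

open Metric Set Filter Pointwise

/-- `γ` restricted to `[0, L]` is a `(lam, c)`-quasi-geodesic parametrized by arc length:
the length of the subpath from `s` to `t` is `t - s`. -/
def IsQuasiGeodesicOn {X : Type*} [MetricSpace X] (γ : ℝ → X) (L lam c : ℝ) : Prop :=
  (∀ s t : ℝ, 0 ≤ s → s ≤ t → t ≤ L → dist (γ s) (γ t) ≤ t - s) ∧
  (∀ s t : ℝ, 0 ≤ s → s ≤ t → t ≤ L → t - s ≤ lam * dist (γ s) (γ t) + c)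

/-- `γ` restricted to `[0, L]` is a geodesic (unit speed). -/
def IsGeodesicOn {X : Type*} [MetricSpace X] (γ : ℝ → X) (L : ℝ) : Prop :=
  ∀ s t : ℝ, s ∈ Set.Icc 0 L → t ∈ Set.Icc 0 L → dist (γ s) (γ t) = |s - t|

/-- A metric space is geodesic if any two points are joined by a geodesic. -/
def GeodesicSpace (X : Type*) [MetricSpace X] : Prop :=
  ∀ x y : X, ∃ γ : ℝ → X, γ 0 = x ∧ γ (dist x y) = y ∧ IsGeodesicOn γ (dist x y)

/-- The path `γ` on `[0, L]` is `M`-Morse: every `(lam, c)`-quasi-geodesic with endpoints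
on `γ` stays within distance `M lam c` of the corresponding subpath of `γ`. -/
def IsMorseOn {X : Type*} [MetricSpace X] (γ : ℝ → X) (L : ℝ) (M : ℝ → ℝ → ℝ) : Prop :=
  ∀ lam c : ℝ, 1 ≤ lam → 0 ≤ c →
    ∀ (β : ℝ → X) (Lβ : ℝ), 0 ≤ Lβ → IsQuasiGeodesicOn β Lβ lam c →
      ∀ s t : ℝ, 0 ≤ s → s ≤ t → t ≤ L → β 0 = γ s → β Lβ = γ t →
        ∀ u ∈ Set.Icc (0:ℝ) Lβ, ∃ v ∈ Set.Icc s t, dist (β u) (γ v) ≤ M lam c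

/-- `γ` on `[0, Lγ]` is an `(L; M; lam, c)`-local Morse quasi-geodesic: every subpath of
length at most `L` is an `(M; lam, c)`-Morse quasi-geodesic. -/
def LocalMorseQuasiGeodesicOn {X : Type*} [MetricSpace X] (γ : ℝ → X) (Lγ L : ℝ)
    (M : ℝ → ℝ → ℝ) (lam c : ℝ) : Prop :=
  ∀ s t : ℝ, 0 ≤ s → s ≤ t → t ≤ Lγ → t - s ≤ L →
    IsQuasiGeodesicOn (fun u => γ (s + u)) (t - s) lam c ∧
    IsMorseOn (fun u => γ (s + u)) (t - s) M

/-- Morse local-to-global space. -/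
def MorseLocalToGlobalSpace (X : Type*) [MetricSpace X] : Prop :=
  ∀ (M : ℝ → ℝ → ℝ) (lam c : ℝ), 1 ≤ lam → 0 ≤ c →
    ∃ (M' : ℝ → ℝ → ℝ) (L lam' c' : ℝ), 0 ≤ L ∧ 1 ≤ lam' ∧ 0 ≤ c' ∧
      ∀ (γ : ℝ → X) (Lγ : ℝ), 0 ≤ Lγ → LocalMorseQuasiGeodesicOn γ Lγ L M lam c →
        IsQuasiGeodesicOn γ Lγ lam' c' ∧ IsMorseOn γ Lγ M'

/-- A Morse geodesic ray: an isometric embedding of `[0, ∞)` which is `M`-Morse. -/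
def IsMorseGeodesicRay {X : Type*} [MetricSpace X] (γ : ℝ → X) (M : ℝ → ℝ → ℝ) : Prop :=
  (∀ s t : ℝ, 0 ≤ s → 0 ≤ t → dist (γ s) (γ t) = |s - t|) ∧
  (∀ lam c : ℝ, 1 ≤ lam → 0 ≤ c →
    ∀ (β : ℝ → X) (Lβ : ℝ), 0 ≤ Lβ → IsQuasiGeodesicOn β Lβ lam c →
      ∀ s t : ℝ, 0 ≤ s → s ≤ t → β 0 = γ s → β Lβ = γ t →
        ∀ u ∈ Set.Icc (0:ℝ) Lβ, ∃ v ∈ Set.Icc s t, dist (β u) (γ v) ≤ M lam c)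

/-- The action of `G` on `X` is by isometries. -/
def IsometricAction (G X : Type*) [Group G] [MetricSpace X] [MulAction G X] : Prop :=
  ∀ (g : G) (x y : X), dist (g • x) (g • y) = dist x y

/-- The action of `G` on `X` is (metrically) proper. -/
def ProperAction (G X : Type*) [Group G] [MetricSpace X] [MulAction G X] : Prop :=
  ∀ (x : X) (r : ℝ), 0 < r → {g : G | dist x (g • x) ≤ r}.Finite

/-- The action of `G` on `X` is cocompact. -/
def CocompactAction (G X : Type*) [Group G] [MetricSpace X] [MulAction G X] : Prop :=
  ∃ K : Set X, IsCompact K ∧ ∀ x : X, ∃ g : G, g • x ∈ K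

/-- `H` is a stable subgroup: there are a Morse gauge `M` and `D ≥ 0` such that every
geodesic `[o, h • o]` is `M`-Morse and contained in the `D`-neighborhood of `H • o`. -/
def IsStableSubgroup {X G : Type*} [MetricSpace X] [Group G] [MulAction G X]
    (o : X) (H : Subgroup G) : Prop :=
  ∃ (M : ℝ → ℝ → ℝ) (D : ℝ), 0 ≤ D ∧
    ∀ h ∈ H, ∀ γ : ℝ → X, γ 0 = o → γ (dist o (h • o)) = h • o →
      IsGeodesicOn γ (dist o (h • o)) →
      IsMorseOn γ (dist o (h • o)) M ∧
      ∀ s ∈ Set.Icc 0 (dist o (h • o)), ∃ h' ∈ H, dist (γ s) (h' • o) ≤ D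

/-- A Morse element: an infinite order element generating a stable cyclic subgroup. -/
def IsMorseElement {X G : Type*} [MetricSpace X] [Group G] [MulAction G X]
    (o : X) (g : G) : Prop :=
  ¬ IsOfFinOrder g ∧ IsStableSubgroup o (Subgroup.zpowers g)

/-- `H` is quasi-convex: geodesics with endpoints on `H • o` stay in a `σ`-neighborhood
of `H • o`. -/
def IsQuasiConvexSubgroup {X G : Type*} [MetricSpace X] [Group G] [MulAction G X]
    (o : X) (H : Subgroup G) : Prop :=
  ∃ σ : ℝ, 0 ≤ σ ∧ ∀ h h' : G, h ∈ H → h' ∈ H →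
    ∀ γ : ℝ → X, γ 0 = h • o → γ (dist (h • o) (h' • o)) = h' • o →
      IsGeodesicOn γ (dist (h • o) (h' • o)) →
      ∀ s ∈ Set.Icc 0 (dist (h • o) (h' • o)), ∃ h'' ∈ H, dist (γ s) (h'' • o) ≤ σ

/-- The growth rate `ω(A) = limsup (log #(B(n) ∩ A)) / n` of a subset `A ⊆ G`. -/
noncomputable def growthRate {X G : Type*} [MetricSpace X] [Group G] [MulAction G X]
    (o : X) (A : Set G) : ℝ :=
  Filter.limsup (fun n : ℕ =>
    Real.log ((A ∩ {g : G | dist o (g • o) ≤ (n : ℝ)}).ncard) / (n : ℝ)) Filter.atTop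

/-- Convergence of the Poincaré series `𝒫_A(s) = Σ_{g ∈ A} exp (-s · d_G(1, g))`. -/
def PoincareSummable {X G : Type*} [MetricSpace X] [Group G] [MulAction G X]
    (o : X) (A : Set G) (s : ℝ) : Prop :=
  Summable fun g : A => Real.exp (-s * dist o ((g : G) • o))

/-- A group is virtually cyclic if it has a cyclic subgroup of finite index. -/
def VirtuallyCyclic (G : Type*) [Group G] : Prop :=
  ∃ H : Subgroup G, IsCyclic H ∧ H.FiniteIndex

/-- The annulus set `𝒜(n, Δ) = {h ∈ H : |d_G(1,h) - n| ≤ Δ}`. -/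
def annulus {X G : Type*} [MetricSpace X] [Group G] [MulAction G X]
    (o : X) (H : Subgroup G) (n Δ : ℝ) : Set G :=
  {h : G | h ∈ H ∧ |dist o (h • o) - n| ≤ Δ}

/-- Evaluation of a formal alternating word `a₁b₁a₂b₂⋯aₙbₙ` in `G`. -/
def evalWord {G : Type*} [Group G] (w : List (G × G)) : G :=
  (w.map fun p => p.1 * p.2).prod

/-- The set `𝕎(A, B)` of (nonempty) formal alternating words with letters in `A` and `B`. -/
def AltWords {G : Type*} [Group G] (A B : Set G) : Set (List (G × G)) :=
  {w | w ≠ [] ∧ ∀ p ∈ w, p.1 ∈ A ∧ p.2 ∈ B}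

/-- The nearest-point projection `π_A(x)` of a point to a subset `A ⊆ X`. -/
def projSet {X : Type*} [MetricSpace X] (A : Set X) (x : X) : Set X :=
  {a ∈ A | dist x a = Metric.infDist x A}

/-- The projection `π_A(Y) = ⋃_{y ∈ Y} π_A(y)` of a subset `Y` to `A`. -/
def projSetOf {X : Type*} [MetricSpace X] (A Y : Set X) : Set X :=
  ⋃ y ∈ Y, projSet A y

section QuasiGeodesics

variable {X : Type*} [MetricSpace X]

theorem IsGeodesicOn.isQuasiGeodesicOn {γ : ℝ → X} {L : ℝ} (h : IsGeodesicOn γ L) :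
    IsQuasiGeodesicOn γ L 1 0 := by
  have key : ∀ s t : ℝ, 0 ≤ s → s ≤ t → t ≤ L → dist (γ s) (γ t) = t - s := by
    intro s t hs hst ht
    rw [h s t ⟨hs, by linarith⟩ ⟨by linarith, ht⟩, abs_sub_comm, abs_of_nonneg (by linarith)]
  refine ⟨fun s t hs hst ht => (key s t hs hst ht).le, fun s t hs hst ht => ?_⟩
  rw [key s t hs hst ht]
  linarith

theorem IsQuasiGeodesicOn.reverse {γ : ℝ → X} {L lam c : ℝ} (h : IsQuasiGeodesicOn γ L lam c) :
    IsQuasiGeodesicOn (fun u => γ (L - u)) L lam c := by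
  refine ⟨fun s t hs hst ht => ?_, fun s t hs hst ht => ?_⟩
  · have := h.1 (L - t) (L - s) (by linarith) (by linarith) (by linarith)
    rw [dist_comm] at this
    linarith
  · have := h.2 (L - t) (L - s) (by linarith) (by linarith) (by linarith)
    rw [dist_comm] at this
    linarith

theorem IsQuasiGeodesicOn.subpath {γ : ℝ → X} {L lam c s t : ℝ}
    (h : IsQuasiGeodesicOn γ L lam c) (hs : 0 ≤ s) (ht : t ≤ L) :
    IsQuasiGeodesicOn (fun u => γ (s + u)) (t - s) lam c := by
  refine ⟨fun a b ha hab hb => ?_, fun a b ha hab hb => ?_⟩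
  · have := h.1 (s + a) (s + b) (by linarith) (by linarith) (by linarith)
    linarith
  · have := h.2 (s + a) (s + b) (by linarith) (by linarith) (by linarith)
    linarith

/-- A quasi-geodesic can be extended backwards to start at a nearby point. -/
theorem IsQuasiGeodesicOn.exists_prepend (hgeo : GeodesicSpace X) {β : ℝ → X} {L lam c A : ℝ}
    (h : IsQuasiGeodesicOn β L lam c) (hlam : 1 ≤ lam) (hc : 0 ≤ c) {p : X}
    (hp : dist p (β 0) ≤ A) :
    ∃ β' : ℝ → X, β' 0 = p ∧ (∀ u, 0 ≤ u → β' (A + u) = β u) ∧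
      (∀ u, 0 ≤ u → u ≤ A → dist (β' u) (β 0) ≤ A) ∧
      IsQuasiGeodesicOn β' (L + A) lam (c + A * (lam + 1)) := by
  have hA : 0 ≤ A := dist_nonneg.trans hp
  obtain ⟨e, e0, e1, he⟩ := hgeo p (β 0)
  set d := dist p (β 0) with hd
  have hd0 : 0 ≤ d := dist_nonneg
  have hmem : ∀ u, 0 ≤ u → min u d ∈ Icc 0 d := fun u hu => ⟨le_min hu hd0, min_le_right _ _⟩
  have head : ∀ u v, 0 ≤ u → u ≤ v → dist (e (min u d)) (e (min v d)) ≤ v - u := by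
    intro u v hu huv
    rw [he _ _ (hmem u hu) (hmem v (hu.trans huv)), abs_sub_comm,
      abs_of_nonneg (sub_nonneg.2 (min_le_min_right d huv))]
    rcases le_total u d with h1 | h1 <;> rcases le_total v d with h2 | h2 <;>
      simp only [min_eq_left, min_eq_right, h1, h2] <;> linarith
  have tip : ∀ u, 0 ≤ u → u ≤ A → dist (e (min u d)) (β 0) ≤ A - u := by
    intro u hu huA
    have := head u A hu huA
    rwa [min_eq_right hp, e1] at this
  let β' : ℝ → X := fun u => if u < A then e (min u d) else β (u - A)
  have hlt : ∀ u, u < A → β' u = e (min u d) := fun u hu => if_pos hu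
  have hge : ∀ u, A ≤ u → β' u = β (u - A) := fun u hu => if_neg (not_lt.2 hu)
  refine ⟨β', ?_, ?_, ?_, ?_, ?_⟩
  · rcases hA.eq_or_lt with h0 | h0
    · rw [hge 0 h0.symm.le, ← h0, sub_zero]
      have : d = 0 := le_antisymm (h0 ▸ hp) hd0
      exact (dist_eq_zero.1 this).symm
    · rw [hlt 0 h0, min_eq_left hd0, e0]
  · intro u hu
    rw [hge _ (by linarith)]
    congr 1
    ring
  · intro u hu huA
    rcases huA.lt_or_eq with h1 | h1
    · rw [hlt u h1]
      linarith [tip u hu huA]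
    · rw [hge u h1.ge, h1, sub_self, dist_self]
      exact hA
  · intro s t hs hst ht
    rcases lt_or_ge t A with h1 | h1
    · rw [hlt t h1, hlt s (hst.trans_lt h1)]
      exact head s t hs hst
    · rw [hge t h1]
      rcases lt_or_ge s A with h2 | h2
      · rw [hlt s h2]
        have := h.1 0 (t - A) le_rfl (by linarith) (by linarith)
        linarith [tip s hs h2.le, dist_triangle (e (min s d)) (β 0) (β (t - A))]
      · rw [hge s h2]
        have := h.1 (s - A) (t - A) (by linarith) (by linarith) (by linarith)
        linarith
  · intro s t hs hst ht
    have hAl : 0 ≤ A * lam := mul_nonneg hA (by linarith)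
    have hdl : 0 ≤ lam * dist (β' s) (β' t) := mul_nonneg (by linarith) dist_nonneg
    rcases lt_or_ge t A with h1 | h1
    · linarith
    · rcases lt_or_ge s A with h2 | h2
      · have h3 := h.2 0 (t - A) le_rfl (by linarith) (by linarith)
        have h4 : dist (β 0) (β (t - A)) ≤ dist (β' s) (β' t) + A := by
          rw [hlt s h2, hge t h1]
          linarith [tip s hs h2.le, dist_triangle_left (β 0) (β (t - A)) (e (min s d))]
        have h5 : lam * dist (β 0) (β (t - A)) ≤ lam * (dist (β' s) (β' t) + A) :=
          mul_le_mul_of_nonneg_left h4 (by linarith)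
        linarith
      · have h3 := h.2 (s - A) (t - A) (by linarith) (by linarith) (by linarith)
        rw [← hge s h2, ← hge t h1] at h3
        linarith

/-- A quasi-geodesic can be extended at both ends to join two nearby points. -/
theorem IsQuasiGeodesicOn.exists_extend (hgeo : GeodesicSpace X) {β : ℝ → X} {L lam c A : ℝ}
    (h : IsQuasiGeodesicOn β L lam c) (hL : 0 ≤ L) (hlam : 1 ≤ lam) (hc : 0 ≤ c) {p q : X}
    (hp : dist p (β 0) ≤ A) (hq : dist q (β L) ≤ A) :
    ∃ β' : ℝ → X, β' 0 = p ∧ β' (L + 2 * A) = q ∧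
      (∀ u ∈ Icc 0 L, β' (A + u) = β u) ∧
      (∀ u ∈ Icc 0 (L + 2 * A), ∃ w ∈ Icc 0 L, dist (β' u) (β w) ≤ A) ∧
      IsQuasiGeodesicOn β' (L + 2 * A) lam (c + 2 * A * (lam + 1)) := by
  have hA : 0 ≤ A := dist_nonneg.trans hp
  obtain ⟨β₁, h10, h11, h12, h13⟩ := h.exists_prepend hgeo hlam hc hp
  have hc₁ : 0 ≤ c + A * (lam + 1) := by positivity
  obtain ⟨β₂, h20, h21, h22, h23⟩ := h13.reverse.exists_prepend hgeo hlam hc₁ (p := q) (A := A)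
    (by simpa [add_comm L A, h11 L hL] using hq)
  have mid : ∀ u, u ≤ L + A → β₂ (L + A + A - u) = β₁ u := by
    intro u hu
    have := h21 (L + A - u) (by linarith)
    rw [show L + A + A - u = A + (L + A - u) by ring, this]
    congr 1
    ring
  have e2 : L + 2 * A = L + A + A := by ring
  rw [e2]
  refine ⟨fun u => β₂ (L + A + A - u), ?_, ?_, ?_, ?_, ?_⟩
  · exact (mid 0 (by linarith)).trans h10
  · simpa using h20
  · intro u hu
    have := hu.2
    exact (mid _ (by linarith)).trans (h11 u hu.1)
  · intro u hu
    beta_reduce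
    rcases le_total u (L + A) with h1 | h1
    · rw [mid u h1]
      rcases le_total u A with h2 | h2
      · exact ⟨0, ⟨le_rfl, hL⟩, h12 u hu.1 h2⟩
      · refine ⟨u - A, ⟨by linarith, by linarith⟩, ?_⟩
        rw [← h11 (u - A) (by linarith), add_sub_cancel, dist_self]
        exact hA
    · refine ⟨L, ⟨hL, le_rfl⟩, ?_⟩
      have := h22 (L + A + A - u) (by linarith [hu.2]) (by linarith)
      rwa [sub_zero, add_comm L A, h11 L hL, add_comm A L] at this
  · rw [show c + 2 * A * (lam + 1) = c + A * (lam + 1) + A * (lam + 1) by ring]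
    exact h23.reverse

/-- If two coarsely continuous paths have the same endpoints and one lies in the
`E`-neighborhood of the other, then a converse inclusion also holds. -/
theorem exists_dist_le_of_subset_nhd {P τ : ℝ → X} {a b L lam c E : ℝ} (hL : 0 ≤ L)
    (hlam : 1 ≤ lam)
    (hP₁ : ∀ s t, a ≤ s → s ≤ t → t ≤ b → dist (P s) (P t) ≤ t - s)
    (hP₂ : ∀ s t, a ≤ s → s ≤ t → t ≤ b → t - s ≤ lam * dist (P s) (P t) + c)
    (hτ : ∀ s t, 0 ≤ s → s ≤ t → t ≤ L → dist (τ s) (τ t) ≤ t - s)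
    (h0 : τ 0 = P a) (h1 : τ L = P b)
    (hE : ∀ u ∈ Icc 0 L, ∃ v ∈ Icc a b, dist (τ u) (P v) ≤ E) :
    ∀ v ∈ Icc a b, ∃ w ∈ Icc 0 L, dist (P v) (τ w) ≤ E + lam * (1 + 2 * E) + c := by
  intro v hv
  have hE0 : 0 ≤ E := by
    obtain ⟨_, _, h⟩ := hE 0 ⟨le_rfl, hL⟩
    exact dist_nonneg.trans h
  have close : ∀ w₁ w₂ v₁ v₂, w₁ ∈ Icc 0 L → a ≤ v₁ → v₁ ≤ v → v ≤ v₂ → v₂ ≤ b →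
      dist (τ w₁) (P v₁) ≤ E → dist (τ w₂) (P v₂) ≤ E → dist (τ w₁) (τ w₂) ≤ 1 →
      ∃ w ∈ Icc 0 L, dist (P v) (τ w) ≤ E + lam * (1 + 2 * E) + c := by
    intro w₁ w₂ v₁ v₂ hw a1 a2 a3 a4 d1 d2 d3
    refine ⟨w₁, hw, ?_⟩
    have h2 := hP₂ v₁ v₂ a1 (by linarith) a4
    have h3 := hP₁ v₁ v a1 a2 (by linarith)
    have h4 : dist (P v₁) (P v₂) ≤ 1 + 2 * E := by
      have := dist_triangle4 (P v₁) (τ w₁) (τ w₂) (P v₂)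
      rw [dist_comm (P v₁) (τ w₁)] at this
      linarith
    have h5 := mul_le_mul_of_nonneg_left h4 (show 0 ≤ lam by linarith)
    have h6 := dist_triangle_right (P v) (τ w₁) (P v₁)
    rw [dist_comm (P v) (P v₁), dist_comm (τ w₁) (P v₁), dist_comm (P v₁) (τ w₁)] at h6
    linarith
  have hmem : ∀ i : ℕ, min (i : ℝ) L ∈ Icc 0 L :=
    fun i => ⟨le_min i.cast_nonneg hL, min_le_right _ _⟩
  by_cases hQ : ∀ i : ℕ, (∃ v' ∈ Icc a v, dist (τ (min (i : ℝ) L)) (P v') ≤ E) →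
      ∃ v' ∈ Icc a v, dist (τ (min ((i + 1 : ℕ) : ℝ) L)) (P v') ≤ E
  · have all : ∀ i : ℕ, ∃ v' ∈ Icc a v, dist (τ (min (i : ℝ) L)) (P v') ≤ E := by
      intro i
      induction i with
      | zero =>
        refine ⟨a, ⟨le_rfl, hv.1⟩, ?_⟩
        rw [Nat.cast_zero, min_eq_left hL, h0, dist_self]
        exact hE0
      | succ i ih => exact hQ i ih
    obtain ⟨n, hn⟩ := exists_nat_ge L
    obtain ⟨v', hv', hd⟩ := all n
    rw [min_eq_right hn] at hd
    exact close L L v' b ⟨hL, le_rfl⟩ hv'.1 hv'.2 hv.2 le_rfl hd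
      (by rw [h1, dist_self]; exact hE0) (by rw [dist_self]; exact zero_le_one)
  · push Not at hQ
    obtain ⟨i, ⟨v₁, hv₁, hd₁⟩, hn⟩ := hQ
    obtain ⟨v₂, hv₂, hd₂⟩ := hE _ (hmem (i + 1))
    have hvv : v ≤ v₂ := by
      by_contra hcon
      exact absurd hd₂ (not_le.2 (hn v₂ ⟨hv₂.1, (not_le.1 hcon).le⟩))
    refine close _ _ v₁ v₂ (hmem i) hv₁.1 hv₁.2 hvv hv₂.2 hd₁ hd₂ ?_
    refine (hτ _ _ (hmem i).1 (min_le_min_right L (by push_cast; linarith)) (hmem _).2).trans ?_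
    push_cast
    rcases le_total (i : ℝ) L with h2 | h2
    · rw [min_eq_left h2]
      linarith [min_le_left ((i : ℝ) + 1) L]
    · rw [min_eq_right h2]
      linarith [min_le_right ((i : ℝ) + 1) L]

/-- The distance bound `transferGauge M lam₀ c₀ lam₁ c₁ A` is a Morse gauge for
`(lam₁, c₁)`-quasi-geodesics in the `A`-neighborhood of an `(M; lam₀, c₀)`-Morse quasi-geodesic. -/
noncomputable def transferGauge (M : ℝ → ℝ → ℝ) (lam₀ c₀ lam₁ c₁ A lam c : ℝ) : ℝ :=
  M lam (c + 2 * A * (lam + 1)) + (M lam₁ (c₁ + 2 * A * (lam₁ + 1)) +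
    lam₀ * (1 + 2 * M lam₁ (c₁ + 2 * A * (lam₁ + 1))) + c₀) + A

theorem exists_dist_le_of_endpoints_near (hgeo : GeodesicSpace X) {M : ℝ → ℝ → ℝ}
    {P β τ : ℝ → X} {T L₁ L₂ lam₀ c₀ lam₁ c₁ lam c A a b : ℝ}
    (hP : IsQuasiGeodesicOn P T lam₀ c₀) (hM : IsMorseOn P T M) (hlam₀ : 1 ≤ lam₀)
    (ha : 0 ≤ a) (hab : a ≤ b) (hb : b ≤ T)
    (hβ : IsQuasiGeodesicOn β L₁ lam c) (hL₁ : 0 ≤ L₁) (hlam : 1 ≤ lam) (hc : 0 ≤ c)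
    (hτ : IsQuasiGeodesicOn τ L₂ lam₁ c₁) (hL₂ : 0 ≤ L₂) (hlam₁ : 1 ≤ lam₁) (hc₁ : 0 ≤ c₁)
    (hβ0 : dist (P a) (β 0) ≤ A) (hβ1 : dist (P b) (β L₁) ≤ A)
    (hτ0 : dist (P a) (τ 0) ≤ A) (hτ1 : dist (P b) (τ L₂) ≤ A) :
    ∀ u ∈ Icc 0 L₁, ∃ w ∈ Icc 0 L₂,
      dist (β u) (τ w) ≤ transferGauge M lam₀ c₀ lam₁ c₁ A lam c := by
  intro u hu
  have hA : 0 ≤ A := dist_nonneg.trans hβ0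
  obtain ⟨β', b0, b1, b2, -, b4⟩ := hβ.exists_extend hgeo hL₁ hlam hc hβ0 hβ1
  obtain ⟨τ', t0, t1, -, t3, t4⟩ := hτ.exists_extend hgeo hL₂ hlam₁ hc₁ hτ0 hτ1
  obtain ⟨v, hv, hv'⟩ := hM lam _ hlam (by positivity) β' _ (by linarith) b4 a b ha hab hb b0 b1
    (A + u) ⟨by linarith [hu.1], by linarith [hu.2]⟩
  rw [b2 u hu] at hv'
  obtain ⟨w, hw, hw'⟩ := exists_dist_le_of_subset_nhd (P := P) (τ := τ')
    (show 0 ≤ L₂ + 2 * A by linarith) hlam₀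
    (fun s t h1 h2 h3 => hP.1 s t (ha.trans h1) h2 (h3.trans hb))
    (fun s t h1 h2 h3 => hP.2 s t (ha.trans h1) h2 (h3.trans hb)) t4.1 t0 t1
    (hM lam₁ _ hlam₁ (by positivity) τ' _ (by linarith) t4 a b ha hab hb t0 t1) v hv
  obtain ⟨x, hx, hx'⟩ := t3 w hw
  refine ⟨x, hx, ?_⟩
  unfold transferGauge
  linarith [dist_triangle4 (β u) (P v) (τ' w) (τ x)]

/-- A quasi-geodesic in a neighborhood of a Morse quasi-geodesic is Morse. -/
theorem IsMorseOn.of_near (hgeo : GeodesicSpace X) {M : ℝ → ℝ → ℝ} {P σ : ℝ → X}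
    {T ℓ lam₀ c₀ lam₁ c₁ A : ℝ}
    (hM : IsMorseOn P T M) (hP : IsQuasiGeodesicOn P T lam₀ c₀) (hlam₀ : 1 ≤ lam₀)
    (hσ : IsQuasiGeodesicOn σ ℓ lam₁ c₁) (hlam₁ : 1 ≤ lam₁) (hc₁ : 0 ≤ c₁)
    (hnear : ∀ s ∈ Icc 0 ℓ, ∃ a ∈ Icc 0 T, dist (σ s) (P a) ≤ A) :
    IsMorseOn σ ℓ (transferGauge M lam₀ c₀ lam₁ c₁ A) := by
  intro lam c hlam hc β Lβ hLβ hβ s t hs hst ht h0 h1 u hu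
  obtain ⟨a, ha, ha'⟩ := hnear s ⟨hs, hst.trans ht⟩
  obtain ⟨b, hb, hb'⟩ := hnear t ⟨hs.trans hst, ht⟩
  rw [dist_comm] at ha' hb'
  have hτ := hσ.subpath hs ht
  rcases le_total a b with hab | hab
  · obtain ⟨w, hw, hw'⟩ := exists_dist_le_of_endpoints_near hgeo hP hM hlam₀ ha.1 hab hb.2
      hβ hLβ hlam hc hτ (by linarith) hlam₁ hc₁ (A := A) (by rwa [h0]) (by rwa [h1])
      (by simpa using ha') (by simpa using hb') u hu
    exact ⟨s + w, ⟨by linarith [hw.1], by linarith [hw.2]⟩, hw'⟩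
  · obtain ⟨w, hw, hw'⟩ := exists_dist_le_of_endpoints_near hgeo hP hM hlam₀ hb.1 hab ha.2
      hβ.reverse hLβ hlam hc hτ.reverse (by linarith) hlam₁ hc₁ (A := A) (by simpa [h1] using hb')
      (by simpa [h0] using ha') (by simpa using hb') (by simpa using ha') (Lβ - u)
      ⟨by linarith [hu.2], by linarith [hu.1]⟩
    rw [sub_sub_cancel] at hw'
    exact ⟨s + (t - s - w), ⟨by linarith [hw.2], by linarith [hw.1]⟩, hw'⟩

/-- A sequence of points with jumps of size at most `C` is interpolated by a `1`-Lipschitz path. -/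
theorem exists_path_through (hgeo : GeodesicSpace X) {C : ℝ} (hC : 0 < C) (x : ℕ → X)
    (hx : ∀ i, dist (x i) (x (i + 1)) ≤ C) :
    ∃ P : ℝ → X, (∀ i : ℕ, P (i * C) = x i) ∧
      ∀ s t, 0 ≤ s → s ≤ t → dist (P s) (P t) ≤ t - s := by
  choose e e0 e1 he using fun i => hgeo (x i) (x (i + 1))
  let P : ℝ → X := fun t =>
    e ⌊t / C⌋₊ (min (t - ⌊t / C⌋₊ * C) (dist (x ⌊t / C⌋₊) (x (⌊t / C⌋₊ + 1))))
  have vert : ∀ i : ℕ, P (i * C) = x i := by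
    intro i
    have : ⌊(i : ℝ) * C / C⌋₊ = i := by
      rw [mul_div_cancel_right₀ _ hC.ne', Nat.floor_natCast]
    simp only [P, this, sub_self, min_eq_left dist_nonneg, e0]
  have piece : ∀ (i : ℕ) (t : ℝ), i * C ≤ t → t ≤ (i + 1) * C →
      P t = e i (min (t - i * C) (dist (x i) (x (i + 1)))) := by
    intro i t h1 h2
    rcases h2.lt_or_eq with h3 | h3
    · have : ⌊t / C⌋₊ = i := by
        have h0 : (0 : ℝ) ≤ i * C := by positivity
        rw [Nat.floor_eq_iff (div_nonneg (h0.trans h1) hC.le), le_div_iff₀ hC, div_lt_iff₀ hC]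
        exact ⟨h1, h3⟩
      simp only [P, this]
    · have h4 := vert (i + 1)
      push_cast at h4
      rw [h3, h4, show ((i : ℝ) + 1) * C - i * C = C by ring, min_eq_right (hx i), e1]
  have step : ∀ (i : ℕ) (s t : ℝ), i * C ≤ s → s ≤ t → t ≤ (i + 1) * C →
      dist (P s) (P t) ≤ t - s := by
    intro i s t h1 h2 h3
    have mem : ∀ u, (i : ℝ) * C ≤ u →
        min (u - i * C) (dist (x i) (x (i + 1))) ∈ Icc 0 (dist (x i) (x (i + 1))) :=
      fun u hu => ⟨le_min (by linarith) dist_nonneg, min_le_right _ _⟩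
    rw [piece i s h1 (h2.trans h3), piece i t (h1.trans h2) h3,
      he i _ _ (mem s h1) (mem t (h1.trans h2))]
    refine (abs_min_sub_min_le_max _ _ _ _).trans ?_
    rw [sub_self, abs_zero, max_eq_left (abs_nonneg _), abs_sub_comm, abs_of_nonneg (by linarith)]
    linarith
  refine ⟨P, vert, ?_⟩
  have main : ∀ (n : ℕ) (s t : ℝ), 0 ≤ s → s ≤ t → t ≤ n * C → dist (P s) (P t) ≤ t - s := by
    intro n
    induction n with
    | zero =>
      intro s t h1 h2 h3
      have : s = t := by
        rw [Nat.cast_zero, zero_mul] at h3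
        linarith
      rw [this, dist_self, sub_self]
    | succ n ih =>
      intro s t h1 h2 h3
      push_cast at h3
      rcases le_total t (n * C) with h4 | h4
      · exact ih s t h1 h2 h4
      · rcases le_total s (n * C) with h5 | h5
        · linarith [ih s _ h1 h5 le_rfl, step n _ t le_rfl h4 h3,
            dist_triangle (P s) (P (n * C)) (P t)]
        · exact step n s t h5 h2 h3
  intro s t h1 h2
  obtain ⟨n, hn⟩ := exists_nat_ge (t / C)
  exact main n s t h1 h2 ((div_le_iff₀ hC).1 hn)

end QuasiGeodesics

section Actions

variable {X G : Type*} [MetricSpace X] [Group G] [MulAction G X]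

theorem IsQuasiGeodesicOn.smul (hiso : IsometricAction G X) {γ : ℝ → X} {L lam c : ℝ}
    (h : IsQuasiGeodesicOn γ L lam c) (g : G) :
    IsQuasiGeodesicOn (fun u => g • γ u) L lam c := by
  simpa only [IsQuasiGeodesicOn, hiso g] using h

theorem IsMorseOn.smul (hiso : IsometricAction G X) {γ : ℝ → X} {L : ℝ} {M : ℝ → ℝ → ℝ}
    (h : IsMorseOn γ L M) (g : G) : IsMorseOn (fun u => g • γ u) L M := by
  intro lam c hlam hc β Lβ hLβ hβ s t hs hst ht h0 h1 u hu
  obtain ⟨v, hv, hv'⟩ := h lam c hlam hc _ Lβ hLβ (hβ.smul hiso g⁻¹) s t hs hst ht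
    (by rw [h0, inv_smul_smul]) (by rw [h1, inv_smul_smul]) u hu
  refine ⟨v, hv, ?_⟩
  rwa [← hiso g, smul_inv_smul] at hv'

theorem IsMorseGeodesicRay.isMorseOn {γ : ℝ → X} {M : ℝ → ℝ → ℝ} (h : IsMorseGeodesicRay γ M)
    {j : ℝ} (hj : 0 ≤ j) (L : ℝ) : IsMorseOn (fun u => γ (j + u)) L M := by
  intro lam c hlam hc β Lβ hLβ hβ s t hs hst ht h0 h1 u hu
  obtain ⟨v, hv, hv'⟩ := h.2 lam c hlam hc β Lβ hLβ hβ (j + s) (j + t) (by linarith)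
    (by linarith) h0 h1 u hu
  exact ⟨v - j, ⟨by linarith [hv.1], by linarith [hv.2]⟩, by simpa using hv'⟩

theorem IsMorseGeodesicRay.isGeodesicOn {γ : ℝ → X} {M : ℝ → ℝ → ℝ}
    (h : IsMorseGeodesicRay γ M) {j : ℝ} (hj : 0 ≤ j) (L : ℝ) :
    IsGeodesicOn (fun u => γ (j + u)) L := by
  intro s t hs ht
  rw [h.1 _ _ (by linarith [hs.1]) (by linarith [ht.1])]
  congr 1
  ring

theorem CocompactAction.exists_dist_smul_le (hiso : IsometricAction G X)
    (h : CocompactAction G X) (o : X) : ∃ R : ℝ, 0 ≤ R ∧ ∀ x : X, ∃ g : G, dist x (g • o) ≤ R := by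
  obtain ⟨K, hK, hcov⟩ := h
  obtain ⟨R, hR⟩ := hK.isBounded.subset_closedBall o
  refine ⟨max R 0, le_max_right _ _, fun x => ?_⟩
  obtain ⟨g, hg⟩ := hcov x
  refine ⟨g⁻¹, ?_⟩
  rw [← hiso g, smul_inv_smul]
  exact (mem_closedBall.1 (hR hg)).trans (le_max_left _ _)

/-- In a sequence of group elements with bounded jumps, some pattern of increments of any
prescribed length recurs. -/
theorem ProperAction.exists_recurrence (h : ProperAction G X) (o : X) (g : ℕ → G) {f : ℕ → ℝ}
    (hg : ∀ n r, dist o (((g n)⁻¹ * g (n + r)) • o) ≤ f r) (K : ℕ) :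
    ∃ m N : ℕ, K < N ∧
      ∀ r ≤ K, (g m)⁻¹ * g (m + r) = (g (m + N))⁻¹ * g (m + N + r) := by
  let F : Fin (K + 1) → Set G := fun r => {a | dist o (a • o) ≤ max (f r) 1}
  have hF : ∀ r, Finite (F r) :=
    fun r => (h o (max (f r) 1) (lt_max_of_lt_right one_pos)).to_subtype
  let Φ : ℕ → ∀ r, F r := fun n r =>
    ⟨(g (n * (K + 1)))⁻¹ * g (n * (K + 1) + r), (hg _ _).trans (le_max_left _ _)⟩
  obtain ⟨a, b, hab, hΦ⟩ : ∃ a b, a < b ∧ Φ a = Φ b := by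
    obtain ⟨a, b, hne, hΦ⟩ := Finite.exists_ne_map_eq_of_infinite Φ
    rcases hne.lt_or_gt with hlt | hlt
    · exact ⟨a, b, hlt, hΦ⟩
    · exact ⟨b, a, hlt, hΦ.symm⟩
  obtain ⟨d, rfl⟩ := Nat.exists_eq_add_of_lt hab
  refine ⟨a * (K + 1), (d + 1) * (K + 1), by nlinarith, fun r hr => ?_⟩
  have := congrArg Subtype.val (congrFun hΦ ⟨r, Nat.lt_succ_of_le hr⟩)
  rw [← add_mul, ← add_assoc]
  exact this

/-- An element whose positive powers move the basepoint along a Morse quasi-geodesic at a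
constant pace is a Morse element. -/
theorem isMorseElement_of_path (hiso : IsometricAction G X) (hgeo : GeodesicSpace X) {o : X}
    {h : G} {P : ℝ → X} {M : ℝ → ℝ → ℝ} {τ lam c : ℝ} (hτ : 0 < τ) (hlam : 1 ≤ lam)
    (hP : ∀ k : ℕ, P (k * τ) = h ^ k • o)
    (hqg : ∀ T, 0 ≤ T → IsQuasiGeodesicOn P T lam c)
    (hM : ∀ T, 0 ≤ T → IsMorseOn P T M) : IsMorseElement o h := by
  have hP0 : P 0 = o := by simpa using hP 0
  have hpos : ∀ k : ℕ, 0 ≤ (k : ℝ) * τ := fun k => by positivity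
  have near : ∀ (k : ℕ) (σ : ℝ → X) (ℓ : ℝ), 0 ≤ ℓ → IsGeodesicOn σ ℓ → σ 0 = o →
      σ ℓ = h ^ k • o →
      ∀ s ∈ Icc 0 ℓ, ∃ a ∈ Icc 0 (k * τ), dist (σ s) (P a) ≤ M 1 0 :=
    fun k σ ℓ hℓ hσ h0 h1 => hM _ (hpos k) 1 0 le_rfl le_rfl σ ℓ hℓ hσ.isQuasiGeodesicOn
      0 (k * τ) le_rfl (hpos k) le_rfl (h0.trans hP0.symm) (h1.trans (hP k).symm)
  have orbit : ∀ a, 0 ≤ a → ∃ i : ℕ, dist (P a) (h ^ i • o) ≤ τ := by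
    intro a ha
    refine ⟨⌊a / τ⌋₊, ?_⟩
    have h1 := (le_div_iff₀ hτ).1 (Nat.floor_le (div_nonneg ha hτ.le))
    have h2 := (div_lt_iff₀ hτ).1 (Nat.lt_floor_add_one (a / τ))
    rw [← hP, dist_comm]
    linarith [(hqg a ha).1 _ _ (hpos _) h1 le_rfl]
  constructor
  · intro hfin
    obtain ⟨n, hn, hn1⟩ := isOfFinOrder_iff_pow_eq_one.1 hfin
    obtain ⟨k, hk⟩ := exists_nat_gt (c / τ)
    have h1 := (hqg _ (hpos (n * k))).2 0 _ le_rfl (hpos (n * k)) le_rfl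
    rw [hP, hP0, pow_mul, hn1, one_pow, one_smul, dist_self] at h1
    have h2 := (div_lt_iff₀ hτ).1 hk
    have h3 : (k : ℝ) * τ ≤ ((n * k : ℕ) : ℝ) * τ :=
      mul_le_mul_of_nonneg_right (by exact_mod_cast Nat.le_mul_of_pos_left k hn) hτ.le
    linarith
  · refine ⟨transferGauge M lam c 1 0 (M 1 0), |M 1 0| + τ, by positivity, ?_⟩
    intro h' hh' σ h0 h1 hσ
    set ℓ := dist o (h' • o) with hℓ
    have hℓ0 : 0 ≤ ℓ := dist_nonneg
    obtain ⟨z, rfl⟩ := Subgroup.mem_zpowers_iff.1 hh'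
    obtain ⟨k, rfl | rfl⟩ := Int.eq_nat_or_neg z
    · have hnear := near k σ ℓ hℓ0 hσ h0 (by rw [h1, zpow_natCast])
      refine ⟨(hM _ (hpos k)).of_near hgeo (hqg _ (hpos k)) hlam hσ.isQuasiGeodesicOn le_rfl le_rfl
        hnear, fun s hs => ?_⟩
      obtain ⟨a, ha, ha'⟩ := hnear s hs
      obtain ⟨i, hi⟩ := orbit a ha.1
      refine ⟨h ^ i, Subgroup.npow_mem_zpowers h i, ?_⟩
      linarith [dist_triangle (σ s) (P a) (h ^ i • o), le_abs_self (M 1 0)]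
    · have hrev : IsGeodesicOn (fun u => h ^ k • σ (ℓ - u)) ℓ := by
        intro s t hs ht
        rw [hiso, hσ _ _ ⟨by linarith [hs.2], by linarith [hs.1]⟩
          ⟨by linarith [ht.2], by linarith [ht.1]⟩, abs_sub_comm]
        congr 1
        ring
      have hnear : ∀ s ∈ Icc 0 ℓ, ∃ a ∈ Icc 0 (k * τ), dist (σ s) ((h ^ k)⁻¹ • P a) ≤ M 1 0 := by
        intro s hs
        obtain ⟨a, ha, ha'⟩ := near k _ ℓ hℓ0 hrev
          (by rw [sub_zero, h1, zpow_neg, zpow_natCast, smul_inv_smul])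
          (by rw [sub_self, h0]) (ℓ - s) ⟨by linarith [hs.2], by linarith [hs.1]⟩
        refine ⟨a, ha, ?_⟩
        rwa [sub_sub_cancel, ← hiso (h ^ k)⁻¹, inv_smul_smul] at ha'
      refine ⟨((hM _ (hpos k)).smul hiso _).of_near hgeo ((hqg _ (hpos k)).smul hiso _) hlam
        hσ.isQuasiGeodesicOn le_rfl le_rfl hnear, fun s hs => ?_⟩
      obtain ⟨a, ha, ha'⟩ := hnear s hs
      obtain ⟨i, hi⟩ := orbit a ha.1
      refine ⟨(h ^ k)⁻¹ * h ^ i, mul_mem (inv_mem (Subgroup.npow_mem_zpowers h k))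
        (Subgroup.npow_mem_zpowers h i), ?_⟩
      rw [← hiso (h ^ k)⁻¹, smul_smul] at hi
      linarith [dist_triangle (σ s) ((h ^ k)⁻¹ • P a) (((h ^ k)⁻¹ * h ^ i) • o),
        le_abs_self (M 1 0)]

/-- A path whose vertices, in windows of `K + 1`, fellow-travel translates of a Morse geodesic ray
is a local Morse quasi-geodesic. -/
theorem IsMorseGeodesicRay.localMorseQuasiGeodesicOn (hiso : IsometricAction G X)
    (hgeo : GeodesicSpace X) {γ : ℝ → X} {M : ℝ → ℝ → ℝ} (hγ : IsMorseGeodesicRay γ M)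
    {P : ℝ → X} {x : ℕ → X} {C R L : ℝ} {K : ℕ} (hC : 1 ≤ C) (hR : 0 ≤ R)
    (hLK : L / C + 1 ≤ K)
    (hvert : ∀ i : ℕ, P (i * C) = x i)
    (hlip : ∀ s t, 0 ≤ s → s ≤ t → dist (P s) (P t) ≤ t - s)
    (hwin : ∀ i : ℕ, ∃ (k : G) (j : ℕ), ∀ r ≤ K, dist (x (i + r)) (k • γ (j + r)) ≤ R) (T : ℝ) :
    LocalMorseQuasiGeodesicOn P T L
      (transferGauge M 1 0 C (C * (2 * (C + R) + 1)) (C + R)) C (C * (2 * (C + R) + 1)) := by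
  intro s t hs hst _ hL
  have hC0 : 0 < C := by linarith
  obtain ⟨k, j, hkj⟩ := hwin ⌊s / C⌋₊
  let α : ℝ → X := fun u => k • γ (j + u)
  have hα : IsGeodesicOn α K := by
    intro a b ha hb
    rw [hiso]
    exact hγ.isGeodesicOn j.cast_nonneg K a b ha hb
  have close : ∀ u, s ≤ u → u ≤ t → ∃ r : ℕ, r ≤ K ∧ ⌊u / C⌋₊ = ⌊s / C⌋₊ + r ∧
      dist (P u) (α r) ≤ C + R := by
    intro u hsu hut
    have hu0 : 0 ≤ u / C := div_nonneg (hs.trans hsu) hC0.le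
    obtain ⟨r, hr⟩ := Nat.exists_eq_add_of_le
      (Nat.floor_le_floor (div_le_div_of_nonneg_right hsu hC0.le))
    have h1 := (le_div_iff₀ hC0).1 (Nat.floor_le hu0)
    have h2 := (div_lt_iff₀ hC0).1 (Nat.lt_floor_add_one (u / C))
    have hrK : r ≤ K := by
      have h3 := Nat.floor_le hu0
      have h4 := Nat.lt_floor_add_one (s / C)
      have h5 : u / C ≤ s / C + L / C := by
        rw [← add_div]
        exact div_le_div_of_nonneg_right (by linarith) hC0.le
      rw [hr] at h3
      push_cast at h3
      have : (r : ℝ) ≤ K := by linarith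
      exact_mod_cast this
    refine ⟨r, hrK, hr, ?_⟩
    have h6 := hlip _ u (by positivity) h1
    rw [hvert, dist_comm, hr] at h6
    rw [hr] at h2
    have h7 := hkj r hrK
    have h8 := dist_triangle (P u) (x (⌊s / C⌋₊ + r)) (α r)
    change dist _ (α r) ≤ R at h7
    linarith
  have hqg : IsQuasiGeodesicOn (fun u => P (s + u)) (t - s) C (C * (2 * (C + R) + 1)) := by
    refine ⟨fun a b ha hab hb => ?_, fun a b ha hab hb => ?_⟩
    · have := hlip (s + a) (s + b) (by linarith) (by linarith)
      linarith
    · obtain ⟨r₁, hr₁, e₁, d₁⟩ := close (s + a) (by linarith) (by linarith)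
      obtain ⟨r₂, hr₂, e₂, d₂⟩ := close (s + b) (by linarith) (by linarith)
      have h1 := Nat.floor_le (div_nonneg (show 0 ≤ s + a by linarith) hC0.le)
      have h2 := Nat.lt_floor_add_one ((s + b) / C)
      rw [e₁, le_div_iff₀ hC0] at h1
      rw [e₂, div_lt_iff₀ hC0] at h2
      push_cast at h1 h2
      have h3 := hα r₂ r₁ ⟨by positivity, by exact_mod_cast hr₂⟩
        ⟨by positivity, by exact_mod_cast hr₁⟩
      have h4 : (r₂ : ℝ) - r₁ ≤ dist (P (s + a)) (P (s + b)) + 2 * (C + R) := by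
        have h5 := dist_triangle4 (α r₂) (P (s + b)) (P (s + a)) (α r₁)
        rw [h3, dist_comm (P (s + b))] at h5
        rw [dist_comm] at d₂
        linarith [le_abs_self ((r₂ : ℝ) - r₁)]
      have h6 := mul_le_mul_of_nonneg_left h4 hC0.le
      linarith
  refine ⟨hqg, ?_⟩
  refine IsMorseOn.of_near hgeo ((hγ.isMorseOn j.cast_nonneg K).smul hiso k)
    hα.isQuasiGeodesicOn le_rfl hqg hC (by positivity) fun u hu => ?_
  obtain ⟨r, hr, -, hd⟩ := close (s + u) (by linarith [hu.1]) (by linarith [hu.2])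
  exact ⟨r, ⟨by positivity, by exact_mod_cast hr⟩, hd⟩

end Actions

/-- A group acting geometrically on a proper geodesic Morse local-to-global
space containing a Morse geodesic ray contains a Morse element. -/
theorem exists_morse_element
    {X G : Type*} [MetricSpace X] [ProperSpace X] [Group G] [MulAction G X] (o : X)
    (hiso : IsometricAction G X) (hproper : ProperAction G X)
    (hcocompact : CocompactAction G X)
    (hgeo : GeodesicSpace X) (hmltg : MorseLocalToGlobalSpace X)
    (hray : ∃ (γ : ℝ → X) (M : ℝ → ℝ → ℝ), IsMorseGeodesicRay γ M) :
    ∃ g : G, IsMorseElement o g := by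
  obtain ⟨γ, M, hγ⟩ := hray
  obtain ⟨R, hR, hcov⟩ := hcocompact.exists_dist_smul_le hiso o
  choose a ha using fun n : ℕ => hcov (γ n)
  have hinc : ∀ n r : ℕ, dist o (((a n)⁻¹ * a (n + r)) • o) ≤ 2 * R + r := by
    intro n r
    have h1 := hγ.1 (n : ℝ) ((n + r : ℕ) : ℝ) (by positivity) (by positivity)
    rw [← hiso (a n), smul_smul, mul_inv_cancel_left]
    rw [abs_sub_comm, abs_of_nonneg (by push_cast; linarith [r.cast_nonneg (α := ℝ)])] at h1
    push_cast at h1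
    have h3 := dist_triangle4 (a n • o) (γ n) (γ (n + r : ℕ)) (a (n + r) • o)
    have h4 := ha n
    rw [dist_comm] at h4
    have h5 := ha (n + r)
    push_cast at h3 h5
    linarith
  obtain ⟨C, hC⟩ : ∃ C : ℝ, C = 2 * R + 1 := ⟨_, rfl⟩
  have hC1 : 1 ≤ C := by linarith
  have hC0 : 0 < C := by linarith
  obtain ⟨M', L, lam', c', -, hlam', -, hglobal⟩ :=
    hmltg (transferGauge M 1 0 C (C * (2 * (C + R) + 1)) (C + R)) C (C * (2 * (C + R) + 1)) hC1
      (by positivity)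
  obtain ⟨K, hK⟩ := exists_nat_ge (max (L / C + 1) 1)
  have hLK : L / C + 1 ≤ K := (le_max_left _ _).trans hK
  have hK1 : 1 ≤ K := by exact_mod_cast (le_max_right _ _).trans hK
  obtain ⟨m, N, hKN, hrec⟩ := hproper.exists_recurrence o a hinc K
  have hN : 0 < N := by omega
  let h : G := (a m)⁻¹ * a (m + N)
  let x : ℕ → X := fun i => (h ^ (i / N) * ((a m)⁻¹ * a (m + i % N))) • o
  have hx : ∀ i r, r ≤ K →
      x (i + r) = (h ^ (i / N) * (a m)⁻¹) • a (m + i % N + r) • o := by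
    intro i r hr
    have hi := Nat.mod_lt i hN
    have hdm := Nat.div_add_mod i N
    simp only [x, smul_smul]
    congr 1
    rcases lt_or_ge (i % N + r) N with hlt | hge
    · have e : i + r = i % N + r + N * (i / N) := by omega
      rw [e, Nat.add_mul_div_left _ _ hN, Nat.add_mul_mod_self_left, Nat.div_eq_of_lt hlt,
        Nat.mod_eq_of_lt hlt, zero_add, mul_assoc, add_assoc]
    · obtain ⟨q, hq⟩ := Nat.exists_eq_add_of_le hge
      have hqN : q < N := by omega
      have e : i + r = q + N * (i / N + 1) := by rw [mul_add]; omega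
      rw [e, Nat.add_mul_div_left _ _ hN, Nat.add_mul_mod_self_left, Nat.div_eq_of_lt hqN,
        Nat.mod_eq_of_lt hqN, zero_add, hrec q (by omega), pow_succ, add_assoc m (i % N), hq, ← add_assoc]
      simp only [h]
      group
  have hwin : ∀ i : ℕ, ∃ (k : G) (j : ℕ), ∀ r ≤ K, dist (x (i + r)) (k • γ (j + r)) ≤ R := by
    intro i
    refine ⟨h ^ (i / N) * (a m)⁻¹, m + i % N, fun r hr => ?_⟩
    rw [hx i r hr, hiso, dist_comm, ← Nat.cast_add]
    exact ha _
  have hstep : ∀ i, dist (x i) (x (i + 1)) ≤ C := by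
    intro i
    have h0 := hx i 0 (Nat.zero_le K)
    have h1 := hinc (m + i % N) 1
    rw [← hiso (a (m + i % N)), smul_smul, mul_inv_cancel_left] at h1
    rw [add_zero, add_zero] at h0
    rw [h0, hx i 1 hK1, hiso, hC]
    exact_mod_cast h1
  obtain ⟨P, hvert, hlip⟩ := exists_path_through hgeo hC0 x hstep
  have hmorse := fun T hT => hglobal P T hT
    (hγ.localMorseQuasiGeodesicOn hiso hgeo hC1 hR hLK hvert hlip hwin T)
  refine ⟨h, isMorseElement_of_path hiso hgeo (τ := N * C) (by positivity) hlam' (fun k => ?_)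
    (fun T hT => (hmorse T hT).1) fun T hT => (hmorse T hT).2⟩
  rw [← mul_assoc, ← Nat.cast_mul, hvert]
  simp [x, hN]
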